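/- arXiv:2304.06060 — 2 statements merged into one kernel-verified Lean document; each statement's English description precedes it below -/
import Mathlib

section
/- (Theorem 1: characteristic exponent of the GTS distribution.) Let 0 < β₊ < 1, 0 < β₋ < 1, α₊ ≥ 0, α₋ ≥ 0, λ₊ > 0, λ₋ > 0, μ ∈ ℝ. For every ξ ∈ ℝ, the integral ∫_ℝ (e^{iξx} − 1) v(x) dx converges, and iμξ + ∫_ℝ (e^{iξx} − 1) v(x) dx = Ψ(ξ), where Ψ(ξ) = iμξ + α₊Γ(−β₊)((λ₊ − iξ)^{β₊} − λ₊^{β₊}) + α₋Γ(−β₋)((λ₋ + iξ)^{β₋} − λ₋^{β₋}). -/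
open MeasureTheory Complex Set

/-- The GTS Lévy density with parameters `(β₊, β₋, α₊, α₋, λ₊, λ₋)`:
`v(x) = α₊ e^{−λ₊x} x^{−1−β₊}` for `x > 0`,
`v(x) = α₋ e^{−λ₋|x|} |x|^{−1−β₋}` for `x < 0`, and `v(0) = 0`. -/
noncomputable def gtsLevyDensity (βp βm αp αm lp lm : ℝ) (x : ℝ) : ℝ :=
  if 0 < x then αp * Real.exp (-lp * x) * x ^ (-1 - βp)
  else if x < 0 then αm * Real.exp (-lm * |x|) * |x| ^ (-1 - βm)
  else 0

/-- The GTS characteristic exponent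
`Ψ(ξ) = iμξ + α₊Γ(−β₊)((λ₊ − iξ)^{β₊} − λ₊^{β₊}) + α₋Γ(−β₋)((λ₋ + iξ)^{β₋} − λ₋^{β₋})`,
with principal-branch complex powers. -/
noncomputable def gtsPsi (μ βp βm αp αm lp lm : ℝ) (ξ : ℝ) : ℂ :=
  Complex.I * μ * ξ
    + (αp : ℂ) * ((Real.Gamma (-βp) : ℝ) : ℂ) *
        (((lp : ℂ) - Complex.I * ξ) ^ (βp : ℂ) - (lp : ℂ) ^ (βp : ℂ))
    + (αm : ℂ) * ((Real.Gamma (-βm) : ℝ) : ℂ) *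
        (((lm : ℂ) + Complex.I * ξ) ^ (βm : ℂ) - (lm : ℂ) ^ (βm : ℂ))

open Filter Topology

lemma integrableOn_rpow_mul_cexp_neg_mul {s : ℝ} (hs : -1 < s) {z : ℂ} (hz : 0 < z.re) :
    IntegrableOn (fun x : ℝ => ((x ^ s : ℝ) : ℂ) * cexp (-(z * x))) (Ioi 0) := by
  have h := integrableOn_rpow_mul_exp_neg_mul_rpow hs one_pos hz
  refine Integrable.mono' h (by fun_prop) ?_
  filter_upwards [ae_restrict_mem measurableSet_Ioi] with x hx
  rw [mem_Ioi] at hx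
  rw [norm_mul, norm_real, Real.norm_of_nonneg (by positivity), norm_exp]
  simp

lemma differentiableOn_integral_rpow_mul_cexp_neg_mul {s : ℝ} (hs : -1 < s) :
    DifferentiableOn ℂ
      (fun z : ℂ => ∫ x in Ioi (0 : ℝ), ((x ^ s : ℝ) : ℂ) * cexp (-(z * x))) {z | 0 < z.re} := by
  intro z hz
  replace hz : 0 < z.re := hz
  refine DifferentiableAt.differentiableWithinAt ?_
  have hnhds : {w : ℂ | z.re / 2 < w.re} ∈ 𝓝 z :=
    (isOpen_lt continuous_const continuous_re).mem_nhds (by simpa using hz)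
  refine (hasDerivAt_integral_of_dominated_loc_of_deriv_le (𝕜 := ℂ)
    (μ := volume.restrict (Ioi 0)) hnhds
    (F := fun w x => ((x ^ s : ℝ) : ℂ) * cexp (-(w * x)))
    (F' := fun w x => ((x ^ s : ℝ) : ℂ) * (cexp (-(w * x)) * (-x)))
    (bound := fun x => x ^ (s + 1) * Real.exp (-(z.re / 2) * x ^ (1 : ℝ)))
    (.of_forall fun w => by fun_prop) (integrableOn_rpow_mul_cexp_neg_mul hs hz)
    (by fun_prop) ?_
    (integrableOn_rpow_mul_exp_neg_mul_rpow (by linarith) one_pos (half_pos hz))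
    ?_).2.differentiableAt
  · filter_upwards [ae_restrict_mem measurableSet_Ioi] with x hx w hw
    rw [mem_Ioi] at hx
    rw [norm_mul, norm_mul, norm_neg, norm_real, norm_real, norm_exp,
      Real.norm_of_nonneg (by positivity), Real.norm_of_nonneg hx.le, Real.rpow_add_one hx.ne',
      Real.rpow_one, mul_comm (Real.exp _), mul_assoc]
    gcongr
    simp only [neg_re, mul_re, ofReal_re, ofReal_im, mul_zero, sub_zero]
    nlinarith
  · filter_upwards with x w _
    refine (HasDerivAt.cexp ?_).const_mul _
    simpa using ((hasDerivAt_id w).mul_const (x : ℂ)).fun_neg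

/-- The Gamma integral `∫ x ^ (s - 1) * exp (-z x)` for complex `z` in the right half-plane. -/
lemma integral_rpow_mul_cexp_neg_mul {s : ℝ} (hs : 0 < s) {z : ℂ} (hz : 0 < z.re) :
    ∫ x in Ioi (0 : ℝ), ((x ^ (s - 1) : ℝ) : ℂ) * cexp (-(z * x)) =
      z ^ (-s : ℂ) * (Real.Gamma s : ℂ) := by
  have hopen : IsOpen {z : ℂ | 0 < z.re} := isOpen_lt continuous_const continuous_re
  have hl := (differentiableOn_integral_rpow_mul_cexp_neg_mul
    (show -1 < s - 1 by linarith)).analyticOnNhd hopen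
  have hr : AnalyticOnNhd ℂ (fun z : ℂ => z ^ (-s : ℂ) * (Real.Gamma s : ℂ)) {z | 0 < z.re} := by
    refine DifferentiableOn.analyticOnNhd (fun w hw => ?_) hopen
    exact ((differentiableAt_id.cpow_const (Or.inl hw)).mul_const _).differentiableWithinAt
  refine hl.eqOn_of_preconnected_of_frequently_eq hr
    (convex_halfSpace_re_gt 0).isPreconnected (z₀ := ((1 : ℝ) : ℂ)) (by simp) ?_ hz
  have hreal : ∀ r : ℝ, 0 < r →
      ∫ x in Ioi (0 : ℝ), ((x ^ (s - 1) : ℝ) : ℂ) * cexp (-((r : ℂ) * x)) =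
        (r : ℂ) ^ (-s : ℂ) * (Real.Gamma s : ℂ) := by
    intro r hr0
    have h := Real.integral_rpow_mul_exp_neg_mul_Ioi hs hr0
    rw [one_div, Real.inv_rpow hr0.le, ← Real.rpow_neg hr0.le] at h
    rw [← ofReal_neg, ← ofReal_cpow hr0.le, ← ofReal_mul, ← h, ← integral_complex_ofReal]
    simp
  have hmap : Tendsto ((↑) : ℝ → ℂ) (𝓝[≠] (1 : ℝ)) (𝓝[≠] ((1 : ℝ) : ℂ)) :=
    continuous_ofReal.continuousAt.continuousWithinAt.tendsto_nhdsWithin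
      fun x hx => by simpa using hx
  refine hmap.frequently (Eventually.frequently ?_)
  filter_upwards [nhdsWithin_le_nhds (lt_mem_nhds one_pos)] with r hr0 using hreal r hr0

lemma norm_cexp_sub_one_mul_rpow_le {lam x : ℝ} (a ξ : ℝ) (hx : 0 < x) :
    ‖(cexp (I * ξ * x) - 1) * ((Real.exp (-lam * x) * x ^ a : ℝ) : ℂ)‖ ≤
      |ξ| * (x ^ (a + 1) * Real.exp (-lam * x)) := by
  have h := Real.norm_exp_I_mul_ofReal_sub_one_le (x := ξ * x)
  rw [ofReal_mul, ← mul_assoc, norm_mul, Real.norm_eq_abs, Real.norm_eq_abs, abs_of_pos hx] at h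
  rw [norm_mul, norm_real, Real.norm_of_nonneg (by positivity), Real.rpow_add_one hx.ne']
  calc _ ≤ |ξ| * x * (Real.exp (-lam * x) * x ^ a) := by gcongr
    _ = _ := by ring

lemma integrableOn_cexp_sub_one_mul_rpow {β lam : ℝ} (hβ1 : β < 1) (hlam : 0 < lam) (ξ : ℝ) :
    IntegrableOn (fun x : ℝ => (cexp (I * ξ * x) - 1) *
      ((Real.exp (-lam * x) * x ^ (-1 - β) : ℝ) : ℂ)) (Ioi 0) := by
  have h := (integrableOn_rpow_mul_exp_neg_mul_rpow (s := -1 - β + 1) (by linarith)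
    one_pos hlam).const_mul |ξ|
  refine Integrable.mono' h (by fun_prop) ?_
  filter_upwards [ae_restrict_mem measurableSet_Ioi] with x hx
  simpa using norm_cexp_sub_one_mul_rpow_le (-1 - β) ξ hx

lemma integral_cexp_sub_one_mul_rpow {β lam : ℝ} (hβ0 : 0 < β) (hβ1 : β < 1) (hlam : 0 < lam)
    (ξ : ℝ) :
    ∫ x in Ioi (0 : ℝ), (cexp (I * ξ * x) - 1) *
      ((Real.exp (-lam * x) * x ^ (-1 - β) : ℝ) : ℂ) =
      (Real.Gamma (-β) : ℂ) * ((lam - I * ξ) ^ (β : ℂ) - (lam : ℂ) ^ (β : ℂ)) := by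
  set z : ℂ := lam - I * ξ with hz
  have hzre : z.re = lam := by simp [hz]
  have hz0 : z ≠ 0 := fun h => hlam.ne' (by rw [← hzre, h, zero_re])
  have hlam0 : (lam : ℂ) ≠ 0 := ofReal_ne_zero.mpr hlam.ne'
  let u : ℝ → ℂ := fun x => cexp (-(z * x)) - cexp (-(lam * x))
  let u' : ℝ → ℂ := fun x => cexp (-(z * x)) * (-z) - cexp (-(lam * x)) * (-lam)
  let v : ℝ → ℂ := fun x => ((x ^ (-β) / (-β) : ℝ) : ℂ)
  let v' : ℝ → ℂ := fun x => ((x ^ (-1 - β) : ℝ) : ℂ)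
  have hfac : ∀ (x y : ℝ), (cexp (I * ξ * x) - 1) * ((Real.exp (-lam * x) * y : ℝ) : ℂ) =
      u x * (y : ℂ) := by
    intro x y
    have : cexp (-(z * x)) = cexp (I * ξ * x) * cexp (-(lam * x)) := by
      rw [← Complex.exp_add, hz]; ring_nf
    simp only [u, this]
    push_cast
    rw [neg_mul]
    ring
  have hexp : ∀ (w : ℂ) (x : ℝ), HasDerivAt (fun x : ℝ => cexp (-(w * x)))
      (cexp (-(w * x)) * (-w)) x := fun w x => by
    refine HasDerivAt.cexp ?_
    simpa using (((hasDerivAt_id x).ofReal_comp).const_mul w).fun_neg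
  have hu : ∀ x ∈ Ioi (0 : ℝ), HasDerivAt u (u' x) x := fun x _ => (hexp z x).sub (hexp lam x)
  have hv : ∀ x ∈ Ioi (0 : ℝ), HasDerivAt v (v' x) x := fun x hx => by
    refine HasDerivAt.ofReal_comp (f := fun x : ℝ => x ^ (-β) / (-β)) ?_
    convert! (Real.hasDerivAt_rpow_const (p := -β) (Or.inl (ne_of_gt hx))).div_const (-β) using 1
    rw [mul_div_cancel_left₀ _ (neg_ne_zero.mpr hβ0.ne')]
    ring_nf
  have huv' : IntegrableOn (u * v') (Ioi 0) := by
    refine (integrableOn_cexp_sub_one_mul_rpow hβ1 hlam ξ).congr_fun (fun x _ => ?_)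
      measurableSet_Ioi
    exact hfac x _
  have hint : ∀ w : ℂ, 0 < w.re →
      IntegrableOn (fun x : ℝ => w / β * (((x ^ (-β) : ℝ) : ℂ) * cexp (-(w * x)))) (Ioi 0) :=
    fun w hw => (integrableOn_rpow_mul_cexp_neg_mul (by linarith) hw).const_mul _
  have hu'v_eq : ∀ x : ℝ, u' x * v x = z / β * (((x ^ (-β) : ℝ) : ℂ) * cexp (-(z * x))) -
      lam / β * (((x ^ (-β) : ℝ) : ℂ) * cexp (-(lam * x))) := by
    intro x
    have : (β : ℂ) ≠ 0 := ofReal_ne_zero.mpr hβ0.ne'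
    simp only [u', v]
    push_cast
    field_simp
    ring
  have hzpos : 0 < z.re := hzre ▸ hlam
  have hlampos : 0 < (lam : ℂ).re := by simpa
  have hu'v : IntegrableOn (u' * v) (Ioi 0) :=
    ((hint z hzpos).sub (hint lam hlampos)).congr_fun (fun x _ => (hu'v_eq x).symm)
      measurableSet_Ioi
  have hbound : ∀ x : ℝ, 0 < x →
      ‖(u * v) x‖ ≤ |ξ| / β * (x ^ (1 - β) * Real.exp (-lam * x)) := by
    intro x hx
    have h := norm_cexp_sub_one_mul_rpow_le (lam := lam) (-β) ξ hx
    rw [hfac, norm_mul, neg_add_eq_sub] at h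
    have hvx : ‖v x‖ = ‖((x ^ (-β) : ℝ) : ℂ)‖ / β := by
      simp only [v, norm_real, norm_div, norm_neg, Real.norm_of_nonneg hβ0.le]
    rw [Pi.mul_apply, norm_mul, hvx, mul_div_assoc', div_mul_eq_mul_div]
    gcongr
  have h_zero : Tendsto (u * v) (𝓝[>] 0) (𝓝 0) := by
    refine squeeze_zero_norm' (by filter_upwards [self_mem_nhdsWithin] using hbound) ?_
    have hc : ContinuousAt (fun x : ℝ => |ξ| / β * (x ^ (1 - β) * Real.exp (-lam * x))) 0 :=
      continuousAt_const.mul ((Real.continuousAt_rpow_const _ _ (Or.inr (by linarith))).mul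
        (by fun_prop))
    have := hc.tendsto.mono_left (nhdsWithin_le_nhds (s := Ioi 0))
    simpa [Real.zero_rpow (sub_pos.mpr hβ1).ne'] using this
  have h_infty : Tendsto (u * v) atTop (𝓝 0) := by
    refine squeeze_zero_norm' (by filter_upwards [eventually_gt_atTop 0] using hbound) ?_
    simpa using (tendsto_rpow_mul_exp_neg_mul_atTop_nhds_zero (1 - β) lam hlam).const_mul (|ξ| / β)
  have hgamma : ∀ w : ℂ, w ≠ 0 → 0 < w.re →
      ∫ x in Ioi (0 : ℝ), w / β * (((x ^ (-β) : ℝ) : ℂ) * cexp (-(w * x))) =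
        -(Real.Gamma (-β) : ℂ) * w ^ (β : ℂ) := by
    intro w hw0 hw
    have h := integral_rpow_mul_cexp_neg_mul (sub_pos.mpr hβ1) hw
    have hΓ := Real.Gamma_add_one (s := -β) (neg_ne_zero.mpr hβ0.ne')
    rw [neg_add_eq_sub] at hΓ
    rw [show 1 - β - 1 = -β by ring, hΓ] at h
    have hpow : w ^ (-((1 - β : ℝ) : ℂ)) = w ^ (β : ℂ) / w := by
      rw [show -((1 - β : ℝ) : ℂ) = (β : ℂ) - 1 by push_cast; ring, cpow_sub _ _ hw0, cpow_one]
    rw [integral_const_mul, h, hpow]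
    have : (β : ℂ) ≠ 0 := ofReal_ne_zero.mpr hβ0.ne'
    push_cast
    field_simp
  have key := integral_Ioi_mul_deriv_eq_deriv_mul hu hv huv' hu'v h_zero h_infty
  simp_rw [hfac]
  rw [key]
  simp_rw [hu'v_eq]
  rw [integral_sub (hint z hzpos) (hint lam hlampos), hgamma z hz0 hzpos,
    hgamma lam hlam0 hlampos]
  ring

/-- Theorem 1 (characteristic exponent of the GTS distribution): for every `ξ`,
`∫_ℝ (e^{iξx} − 1) v(x) dx` converges and `iμξ + ∫_ℝ (e^{iξx} − 1) v(x) dx = Ψ(ξ)`. -/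
theorem gts_characteristic_exponent (μ βp βm αp αm lp lm : ℝ)
    (hβp0 : 0 < βp) (hβp1 : βp < 1) (hβm0 : 0 < βm) (hβm1 : βm < 1)
    (hαp : 0 ≤ αp) (hαm : 0 ≤ αm) (hlp : 0 < lp) (hlm : 0 < lm) (ξ : ℝ) :
    Integrable (fun x : ℝ => (Complex.exp (Complex.I * ξ * x) - 1) *
        ((gtsLevyDensity βp βm αp αm lp lm x : ℝ) : ℂ)) ∧
    Complex.I * μ * ξ + ∫ x : ℝ, (Complex.exp (Complex.I * ξ * x) - 1) *
        ((gtsLevyDensity βp βm αp αm lp lm x : ℝ) : ℂ)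
      = gtsPsi μ βp βm αp αm lp lm ξ := by
  set f : ℝ → ℂ := fun x => (cexp (I * ξ * x) - 1) *
    ((gtsLevyDensity βp βm αp αm lp lm x : ℝ) : ℂ) with hf
  have hpos : EqOn f (fun x : ℝ => (αp : ℂ) * ((cexp (I * ξ * x) - 1) *
      ((Real.exp (-lp * x) * x ^ (-1 - βp) : ℝ) : ℂ))) (Ioi 0) := by
    intro x hx
    rw [mem_Ioi] at hx
    simp only [hf, gtsLevyDensity, if_pos hx]
    push_cast
    ring
  have hneg : EqOn (fun x => f (-x)) (fun x : ℝ => (αm : ℂ) *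
      ((cexp (I * ((-ξ : ℝ) : ℂ) * x) - 1) *
        ((Real.exp (-lm * x) * x ^ (-1 - βm) : ℝ) : ℂ))) (Ioi 0) := by
    intro x hx
    rw [mem_Ioi] at hx
    simp only [hf, gtsLevyDensity, if_neg (neg_nonpos.mpr hx.le).not_gt,
      if_pos (neg_neg_iff_pos.mpr hx), abs_neg, abs_of_pos hx]
    push_cast
    ring_nf
  have hIoi : IntegrableOn f (Ioi 0) :=
    IntegrableOn.congr_fun ((integrableOn_cexp_sub_one_mul_rpow hβp1 hlp ξ).const_mul (αp : ℂ))
      hpos.symm measurableSet_Ioi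
  have hIic : IntegrableOn f (Iic 0) := by
    have h : IntegrableOn (fun x => f (-x)) (Ioi 0) :=
      IntegrableOn.congr_fun
        ((integrableOn_cexp_sub_one_mul_rpow hβm1 hlm (-ξ)).const_mul (αm : ℂ)) hneg.symm
        measurableSet_Ioi
    rw [← neg_zero] at h
    simpa [integrableOn_Iic_iff_integrableOn_Iio] using h.comp_neg_Iio
  refine ⟨?_, ?_⟩
  · rw [← integrableOn_univ, ← Iic_union_Ioi (a := (0 : ℝ))]
    exact hIic.union hIoi
  · have hm : ∫ x in Iic (0 : ℝ), f x = ∫ x in Ioi (0 : ℝ), f (-x) := by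
      rw [integral_comp_neg_Ioi, neg_zero]
    rw [← intervalIntegral.integral_Iic_add_Ioi hIic hIoi, hm,
      setIntegral_congr_fun measurableSet_Ioi hpos, setIntegral_congr_fun measurableSet_Ioi hneg,
      integral_const_mul, integral_const_mul, integral_cexp_sub_one_mul_rpow hβp0 hβp1 hlp,
      integral_cexp_sub_one_mul_rpow hβm0 hβm1 hlm, gtsPsi]
    push_cast
    ring_nf
end

section
/- (Theorem 3: generalized Black–Scholes / Fourier pricing formula.) Let S > 0, K > 0, q < −1, and let f : ℝ → ℝ be a probability density (nonnegative, measurable, ∫_ℝ f = 1) such that ∫_ℝ e^{−qx} f(x) dx < ∞. For complex z with 0 ≤ Im(z) ≤ −q define Φ(z) = ∫_ℝ e^{izx} f(x) dx. Then ∫_ℝ max(S e^{x} − K, 0)·f(x) dx = (K/2π)·∫_ℝ e^{i(u+iq)·log(S/K)}·Φ(u + iq) / (i(u+iq)·(i(u+iq) − 1)) du, both integrals being absolutely convergent. -/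
open MeasureTheory Complex Set

/-- The function `t ↦ (t⁻¹ - 1)⁺` on the positive half-line, as a combination of truncated powers. -/
theorem indicator_cpow_neg_one_sub_indicator_one {t : ℝ} (ht : 0 < t) :
    indicator (Ioc 0 1) (fun t : ℝ => (t : ℂ) ^ (-1 : ℂ)) t -
        indicator (Ioc 0 1) (fun _ : ℝ => (1 : ℂ)) t = ((max (t⁻¹ - 1) 0 : ℝ) : ℂ) := by
  by_cases h : t ≤ 1
  · have hmem : t ∈ Ioc (0 : ℝ) 1 := ⟨ht, h⟩
    have h1 : 1 ≤ t⁻¹ := (one_le_inv₀ ht).2 h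
    rw [indicator_of_mem hmem, indicator_of_mem hmem, max_eq_left (by linarith), cpow_neg_one]
    push_cast
    rfl
  · have hmem : t ∉ Ioc (0 : ℝ) 1 := fun hm => h hm.2
    have h1 : t⁻¹ ≤ 1 := inv_le_one_of_one_le₀ (not_le.1 h).le
    rw [indicator_of_notMem hmem, indicator_of_notMem hmem, max_eq_right (by linarith)]
    simp

/-- The Mellin transform of the payoff `t ↦ (t⁻¹ - 1)⁺` is `1 / (s (s - 1))`. -/
theorem hasMellin_indicator_cpow_neg_one_sub_indicator_one {s : ℂ} (hs : 1 < s.re) :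
    HasMellin (fun t : ℝ => indicator (Ioc 0 1) (fun t : ℝ => (t : ℂ) ^ (-1 : ℂ)) t -
      indicator (Ioc 0 1) (fun _ : ℝ => (1 : ℂ)) t) s (1 / (s * (s - 1))) := by
  have h1 := hasMellin_cpow_Ioc (-1) (s := s) (by simp; linarith)
  have h2 := hasMellin_one_Ioc (s := s) (by linarith)
  have h := hasMellin_sub h1.1 h2.1
  rw [h1.2, h2.2] at h
  have hs0 : s ≠ 0 := by rintro rfl; simp at hs; linarith
  have hs1 : s - 1 ≠ 0 := by
    intro h0
    rw [sub_eq_zero.1 h0] at hs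
    simp at hs
  have hval : 1 / (s + -1) - 1 / s = 1 / (s * (s - 1)) := by
    rw [← sub_eq_add_neg]
    field_simp
    ring
  rwa [hval] at h

/-- `1 / (s (s - 1))` is integrable along every vertical line to the right of `1`. -/
theorem verticalIntegrable_one_div_mul_sub_one {a : ℝ} (ha : 1 < a) :
    VerticalIntegrable (fun s : ℂ => 1 / (s * (s - 1))) a := by
  have hb : 0 < (a - 1) ^ 2 := pow_pos (by linarith) 2
  refine (integrable_inv_one_add_sq.const_mul (1 + ((a - 1) ^ 2)⁻¹)).mono'
    (Measurable.aestronglyMeasurable (by fun_prop)) (Filter.Eventually.of_forall fun u => ?_)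
  have hre : ‖(a + u * I : ℂ) - 1‖ ^ 2 = (a - 1) ^ 2 + u ^ 2 := by
    rw [← normSq_eq_norm_sq, normSq_apply]
    simp
    ring
  have hre' : ‖(a + u * I : ℂ)‖ ^ 2 = a ^ 2 + u ^ 2 := by
    rw [← normSq_eq_norm_sq, normSq_apply]
    simp
    ring
  have hle : ‖(a + u * I : ℂ) - 1‖ ≤ ‖(a + u * I : ℂ)‖ := by
    refine le_of_sq_le_sq ?_ (norm_nonneg _)
    rw [hre, hre']
    nlinarith
  have hmul : (a - 1) ^ 2 + u ^ 2 ≤ ‖(a + u * I : ℂ)‖ * ‖(a + u * I : ℂ) - 1‖ := by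
    rw [← hre, sq]
    gcongr
  rw [norm_div, norm_one, norm_mul]
  refine (one_div_le_one_div_of_le (by positivity) hmul).trans ?_
  rw [← div_eq_mul_inv, div_le_div_iff₀ (by positivity) (by positivity)]
  have : 0 ≤ ((a - 1) ^ 2)⁻¹ * u ^ 2 := by positivity
  have : ((a - 1) ^ 2)⁻¹ * (a - 1) ^ 2 = 1 := inv_mul_cancel₀ hb.ne'
  nlinarith

/-- Fourier representation of the normalized call payoff. -/
theorem integral_exp_div_mul_sub_one {a : ℝ} (ha : 1 < a) (y : ℝ) :
    ∫ u : ℝ, cexp ((a + u * I) * y) / ((a + u * I) * ((a + u * I) - 1)) =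
      2 * Real.pi * ((max (Real.exp y - 1) 0 : ℝ) : ℂ) := by
  have hmellin (u : ℝ) := hasMellin_indicator_cpow_neg_one_sub_indicator_one
    (s := a + u * I) (by simpa using ha)
  have hx : 0 < Real.exp (-y) := Real.exp_pos _
  have hcont : ContinuousAt (fun t : ℝ => ((max (t⁻¹ - 1) 0 : ℝ) : ℂ)) (Real.exp (-y)) := by
    have : ContinuousAt (fun t : ℝ => t⁻¹) (Real.exp (-y)) := continuousAt_inv₀ hx.ne'
    fun_prop
  have hinv := mellinInv_mellin_eq a _ hx (by simpa using (hmellin 0).1)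
    (by
      have h := verticalIntegrable_one_div_mul_sub_one ha
      unfold VerticalIntegrable at h ⊢
      simpa only [(hmellin _).2] using h)
    (hcont.congr ((eventually_gt_nhds hx).mono fun t ht =>
      (indicator_cpow_neg_one_sub_indicator_one ht).symm))
  rw [indicator_cpow_neg_one_sub_indicator_one hx, ← Real.exp_neg, neg_neg, mellinInv] at hinv
  simp only [(hmellin _).2] at hinv
  rw [← hinv, real_smul, ← mul_assoc]
  have hpi : (Real.pi : ℂ) ≠ 0 := ofReal_ne_zero.2 Real.pi_ne_zero
  have hconst : 2 * (Real.pi : ℂ) * ((1 / (2 * Real.pi) : ℝ) : ℂ) = 1 := by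
    push_cast
    field_simp
  rw [hconst, one_mul]
  refine integral_congr_ae (Filter.Eventually.of_forall fun u => ?_)
  have hpow : ((Real.exp (-y) : ℝ) : ℂ) ^ (-(a + u * I : ℂ)) = cexp ((a + u * I) * y) := by
    rw [cpow_def_of_ne_zero (ofReal_ne_zero.2 hx.ne'), ← ofReal_log hx.le, Real.log_exp]
    congr 1
    push_cast
    ring
  simp only [hpow, smul_eq_mul]
  ring

/-- Theorem 3 (generalized Black–Scholes / Fourier pricing formula): for a density `f`
with `∫ e^{−qx} f(x) dx < ∞`, `q < −1`, and `Φ(z) = ∫ e^{izx} f(x) dx`,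
`∫ max(S e^{x} − K, 0) f(x) dx
  = (K/2π)·∫ e^{i(u+iq)·log(S/K)}·Φ(u+iq)/(i(u+iq)·(i(u+iq) − 1)) du`,
both integrals being absolutely convergent. -/
theorem generalized_black_scholes (S K q : ℝ) (hS : 0 < S) (hK : 0 < K) (hq : q < -1)
    (f : ℝ → ℝ) (hf_nonneg : ∀ x, 0 ≤ f x) (hf_meas : Measurable f)
    (hf_int : ∫ x : ℝ, f x = 1)
    (hf_exp : Integrable (fun x : ℝ => Real.exp (-q * x) * f x)) :
    Integrable (fun x : ℝ => max (S * Real.exp x - K) 0 * f x) ∧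
    Integrable (fun u : ℝ =>
      Complex.exp (Complex.I * ((u : ℂ) + Complex.I * q) * (Real.log (S / K) : ℂ)) *
          (∫ x : ℝ, Complex.exp (Complex.I * ((u : ℂ) + Complex.I * q) * x) * (f x : ℂ)) /
        (Complex.I * ((u : ℂ) + Complex.I * q) *
          (Complex.I * ((u : ℂ) + Complex.I * q) - 1))) ∧
    ((∫ x : ℝ, max (S * Real.exp x - K) 0 * f x : ℝ) : ℂ)
      = ((K : ℂ) / (2 * (Real.pi : ℂ))) *
          ∫ u : ℝ,
            Complex.exp (Complex.I * ((u : ℂ) + Complex.I * q) * (Real.log (S / K) : ℂ)) *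
                (∫ x : ℝ, Complex.exp (Complex.I * ((u : ℂ) + Complex.I * q) * x) * (f x : ℂ)) /
              (Complex.I * ((u : ℂ) + Complex.I * q) *
                (Complex.I * ((u : ℂ) + Complex.I * q) - 1)) := by
  have ha : 1 < -q := by linarith
  have hs (u : ℝ) : I * ((u : ℂ) + I * q) = ((-q : ℝ) : ℂ) + u * I := by
    push_cast
    linear_combination (q : ℂ) * I_mul_I
  simp only [hs]
  generalize -q = a at *
  set L := Real.log (S / K) with hL
  let F : ℝ → ℝ → ℂ := fun u x =>
    cexp ((a + u * I) * (x + L : ℝ)) / ((a + u * I) * ((a + u * I) - 1)) * f x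
  have hF : Integrable (Function.uncurry F) (volume.prod volume) := by
    have hexp_int : Integrable fun x : ℝ => ((Real.exp (a * x) * f x : ℝ) : ℂ) := hf_exp.ofReal
    have hprod := (verticalIntegrable_one_div_mul_sub_one ha).mul_prod hexp_int
    refine ((hprod.const_mul (cexp (a * L))).bdd_mul (c := 1)
      (f := fun z : ℝ × ℝ => cexp ((z.1 * (z.2 + L) : ℝ) * I)) (by fun_prop)
      (Filter.Eventually.of_forall fun z => (norm_exp_ofReal_mul_I _).le)).congr
      (Filter.Eventually.of_forall fun z => ?_)
    have hexp : cexp ((a + z.1 * I) * (z.2 + L : ℝ)) =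
        cexp ((z.1 * (z.2 + L) : ℝ) * I) * cexp (a * L) * cexp (a * z.2) := by
      rw [← Complex.exp_add, ← Complex.exp_add]
      congr 1
      push_cast
      ring
    simp only [F, Function.uncurry, hexp]
    push_cast
    ring
  have hleft (u : ℝ) : ∫ x, F u x = cexp ((a + u * I) * L) *
      (∫ x : ℝ, cexp ((a + u * I) * x) * (f x : ℂ)) / ((a + u * I) * ((a + u * I) - 1)) := by
    rw [mul_div_right_comm, ← integral_const_mul]
    refine integral_congr_ae (Filter.Eventually.of_forall fun x => ?_)
    simp only [F]
    push_cast
    rw [mul_add, Complex.exp_add]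
    ring
  have hright (x : ℝ) : ∫ u, F u x =
      ((2 * Real.pi / K * (max (S * Real.exp x - K) 0 * f x) : ℝ) : ℂ) := by
    have hpayoff : max (S * Real.exp x - K) 0 = K * max (Real.exp (x + L) - 1) 0 := by
      rw [mul_max_of_nonneg _ _ hK.le, Real.exp_add, hL, Real.exp_log (div_pos hS hK)]
      congr 1
      · field_simp
      · simp
    simp only [F]
    rw [integral_mul_const, integral_exp_div_mul_sub_one ha, hpayoff]
    have hK' : (K : ℂ) ≠ 0 := ofReal_ne_zero.2 hK.ne'
    push_cast
    field_simp
  have hc : 2 * Real.pi / K ≠ 0 := by positivity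
  refine ⟨?_, ?_, ?_⟩
  · have h : Integrable fun x => ∫ u, F u x := hF.integral_prod_right
    simp only [hright] at h
    exact (integrable_const_mul_iff hc.isUnit _).1 (by simpa using! h.re)
  · have h : Integrable fun u => ∫ x, F u x := hF.integral_prod_left
    simpa only [hleft] using h
  · simp only [← hleft]
    rw [integral_integral_swap hF]
    simp only [hright]
    rw [integral_complex_ofReal, integral_const_mul]
    have hK' : (K : ℂ) ≠ 0 := ofReal_ne_zero.2 hK.ne'
    have hpi : (Real.pi : ℂ) ≠ 0 := ofReal_ne_zero.2 Real.pi_ne_zero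
    push_cast
    field_simp
end
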